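/- Define k = k(H) ∈ (0,1) implicitly by 2K(k)/K(√(1−k²)) = H for H > 0. Then k(H) is well-defined (such k exists and is unique), k(H) → 1 as H → ∞, and ln(1/(1−k(H))) ∼ (π/2)·H as H → ∞. -/

import Mathlib

open Real Filter Set Topology

noncomputable def ellK (r : ℝ) : ℝ :=
  ∫ ξ in (0:ℝ)..1, 1 / Real.sqrt ((1 - ξ ^ 2) * (1 - r ^ 2 * ξ ^ 2))

theorem intervalIntegrable_one_div_sqrt_one_sub_sq :
    IntervalIntegrable (fun x : ℝ => 1 / √(1 - x ^ 2)) MeasureTheory.volume 0 1 := by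
  apply intervalIntegral.intervalIntegrable_deriv_of_nonneg (g := Real.arcsin)
    Real.continuous_arcsin.continuousOn
  · intro x hx
    simp at hx
    exact Real.hasDerivAt_arcsin (by linarith) (by linarith)
  · intro x _
    positivity

theorem ellK_zero : ellK 0 = π / 2 := by
  have h := intervalIntegral.integral_eq_sub_of_hasDerivAt_of_le (zero_le_one (α := ℝ))
    Real.continuous_arcsin.continuousOn
    (fun x hx => Real.hasDerivAt_arcsin (by linarith [hx.1]) (by linarith [hx.2]))
    intervalIntegrable_one_div_sqrt_one_sub_sq
  simpa [ellK] using h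

theorem ellK_integrand_eq {r x : ℝ} (hx : x ∈ Icc (0:ℝ) 1) :
    1 / √((1 - x ^ 2) * (1 - r ^ 2 * x ^ 2)) =
      1 / √(1 - x ^ 2) * (1 / √(1 - r ^ 2 * x ^ 2)) := by
  rw [Real.sqrt_mul (by nlinarith [hx.1, hx.2])]
  field_simp

theorem one_sub_sq_le_one_sub_sq_mul_sq {r c x : ℝ} (hr : 0 ≤ r) (hrc : r ≤ c) (hx : x ∈ Icc (0:ℝ) 1) :
    1 - c ^ 2 ≤ 1 - r ^ 2 * x ^ 2 := by
  have h1 : r * x ≤ c := by nlinarith [hx.1, hx.2]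
  nlinarith [mul_nonneg hr hx.1]

theorem norm_ellK_integrand_le {r c x : ℝ} (hr : |r| ≤ c) (hc : c < 1) (hx : x ∈ Icc (0:ℝ) 1) :
    ‖1 / √((1 - x ^ 2) * (1 - r ^ 2 * x ^ 2))‖ ≤ 1 / √(1 - x ^ 2) * (1 / √(1 - c ^ 2)) := by
  have hr0 := abs_nonneg r
  have h := one_sub_sq_le_one_sub_sq_mul_sq hr0 hr hx
  rw [sq_abs] at h
  have hc' : 0 < 1 - c ^ 2 := by nlinarith
  rw [ellK_integrand_eq hx, Real.norm_of_nonneg (by positivity)]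
  gcongr

theorem measurable_ellK_integrand (r : ℝ) :
    Measurable fun x : ℝ => 1 / √((1 - x ^ 2) * (1 - r ^ 2 * x ^ 2)) := by
  fun_prop

theorem intervalIntegrable_ellK {r : ℝ} (hr : |r| < 1) :
    IntervalIntegrable (fun x : ℝ => 1 / √((1 - x ^ 2) * (1 - r ^ 2 * x ^ 2)))
      MeasureTheory.volume 0 1 := by
  refine (intervalIntegrable_one_div_sqrt_one_sub_sq.mul_const (1 / √(1 - |r| ^ 2))).mono_fun'
    (measurable_ellK_integrand r).aestronglyMeasurable ?_
  filter_upwards [MeasureTheory.ae_restrict_mem measurableSet_uIoc] with x hx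
  rw [uIoc_of_le zero_le_one] at hx
  exact norm_ellK_integrand_le le_rfl hr ⟨hx.1.le, hx.2⟩

theorem continuousAt_ellK {r : ℝ} (hr : |r| < 1) : ContinuousAt ellK r := by
  obtain ⟨c, hrc, hc⟩ := exists_between hr
  have hc' : 0 < 1 - c ^ 2 := by nlinarith [abs_nonneg r]
  unfold ellK
  refine intervalIntegral.continuousAt_of_dominated_interval
    (bound := fun x => 1 / √(1 - x ^ 2) * (1 / √(1 - c ^ 2)))
    (.of_forall fun s => (measurable_ellK_integrand s).aestronglyMeasurable) ?_
    (intervalIntegrable_one_div_sqrt_one_sub_sq.mul_const _) ?_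
  · filter_upwards [continuous_abs.continuousAt.eventually_lt_const hrc] with s hs
    refine .of_forall fun x hx => ?_
    rw [uIoc_of_le zero_le_one] at hx
    exact norm_ellK_integrand_le hs.le hc ⟨hx.1.le, hx.2⟩
  · have h1 : ∀ᵐ x : ℝ, x ≠ 1 := by simp [MeasureTheory.ae_iff]
    filter_upwards [h1] with x hx1 hx
    rw [uIoc_of_le zero_le_one] at hx
    have hx2 : x < 1 := lt_of_le_of_ne hx.2 hx1
    have h := one_sub_sq_le_one_sub_sq_mul_sq (abs_nonneg r) hrc.le ⟨hx.1.le, hx.2⟩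
    rw [sq_abs] at h
    have h3 : 0 < (1 - x ^ 2) * (1 - r ^ 2 * x ^ 2) :=
      mul_pos (by nlinarith [hx.1]) (by linarith)
    refine ContinuousAt.div (by fun_prop) (by fun_prop) (Real.sqrt_pos.2 h3).ne'

theorem strictMonoOn_ellK : StrictMonoOn ellK (Ico 0 1) := by
  intro r hr s hs hrs
  have hr' : |r| < 1 := by rw [abs_of_nonneg hr.1]; exact hr.2
  have hs' : |s| < 1 := by rw [abs_of_nonneg hs.1]; exact hs.2
  rw [← sub_pos]
  unfold ellK
  rw [← intervalIntegral.integral_sub (intervalIntegrable_ellK hs') (intervalIntegrable_ellK hr')]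
  refine intervalIntegral.intervalIntegral_pos_of_pos_on
    ((intervalIntegrable_ellK hs').sub (intervalIntegrable_ellK hr')) (fun x hx => ?_) zero_lt_one
  have hx' : x ∈ Icc (0:ℝ) 1 := ⟨hx.1.le, hx.2.le⟩
  have h := one_sub_sq_le_one_sub_sq_mul_sq hs.1 le_rfl hx'
  have h0 : 0 < 1 - s ^ 2 := by nlinarith [hs.1, hs.2]
  have h1 : 0 < 1 - x ^ 2 := by nlinarith [hx.1, hx.2]
  have h2 : r ^ 2 * x ^ 2 < s ^ 2 * x ^ 2 := by
    have := hx.1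
    have := hr.1
    gcongr
  have h3 : 0 < (1 - x ^ 2) * (1 - s ^ 2 * x ^ 2) := mul_pos h1 (by linarith)
  rw [sub_pos]
  gcongr

theorem ellK_pos {r : ℝ} (hr : r ∈ Ico (0:ℝ) 1) : 0 < ellK r := by
  have h := strictMonoOn_ellK.monotoneOn ⟨le_rfl, zero_lt_one⟩ hr hr.1
  rw [ellK_zero] at h
  linarith [Real.pi_pos]

theorem hasDerivAt_log_ratio {r x : ℝ} (hr : r ∈ Ioo (0:ℝ) 1) (hx : x ∈ Icc (0:ℝ) 1) :
    HasDerivAt (fun y => (Real.log (1 + r * y) - Real.log (1 - r * y)) / (2 * r))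
      (1 / (1 - r ^ 2 * x ^ 2)) x := by
  have hr0 := hr.1
  have h1 : 0 < 1 + r * x := by nlinarith [hr.1, hx.1]
  have h2 : 0 < 1 - r * x := by nlinarith [hr.1, hr.2, hx.1, hx.2]
  have h3 : 1 - r ^ 2 * x ^ 2 ≠ 0 := by nlinarith [mul_pos h1 h2]
  have hl : HasDerivAt (fun y : ℝ => r * y) r x := by
    simpa using (hasDerivAt_id x).const_mul r
  refine ((((hl.const_add 1).log h1.ne').sub ((hl.const_sub 1).log h2.ne')).div_const
    (2 * r)).congr_deriv ?_
  field_simp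
  ring

theorem hasDerivAt_sqrt_ratio {r x : ℝ} (hr : r ∈ Ioo (0:ℝ) 1) (hx : x ∈ Ioo (0:ℝ) 1) :
    HasDerivAt (fun y => -(√(1 - y ^ 2) / √(1 - r ^ 2 * y ^ 2)))
      ((1 - r ^ 2) * x / (√(1 - x ^ 2) * √(1 - r ^ 2 * x ^ 2) ^ 3)) x := by
  have h1 : 0 < 1 - x ^ 2 := by nlinarith [hx.1, hx.2]
  have h2 : 0 < 1 - r ^ 2 * x ^ 2 := by
    have := one_sub_sq_le_one_sub_sq_mul_sq hr.1.le le_rfl ⟨hx.1.le, hx.2.le⟩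
    nlinarith [hr.1, hr.2]
  have hq : HasDerivAt (fun y : ℝ => y ^ 2) (2 * x) x := by
    simpa using hasDerivAt_pow 2 x
  have ha := Real.sqrt_pos.2 h1
  have hb := Real.sqrt_pos.2 h2
  have ha2 := Real.sq_sqrt h1.le
  have hb2 := Real.sq_sqrt h2.le
  refine ((((hq.const_sub 1).sqrt h1.ne').div (((hq.const_mul (r ^ 2)).const_sub 1).sqrt h2.ne')
    hb.ne').neg).congr_deriv ?_
  generalize √(1 - x ^ 2) = a at *
  generalize √(1 - r ^ 2 * x ^ 2) = b at *
  field_simp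
  rw [ha2, hb2]
  ring

theorem log_ratio_le_ellK {r : ℝ} (hr : r ∈ Ioo (0:ℝ) 1) :
    (Real.log (1 + r) - Real.log (1 - r)) / (2 * r) ≤ ellK r := by
  have hr' : |r| < 1 := by rw [abs_of_pos hr.1]; exact hr.2
  have h := intervalIntegral.sub_le_integral_of_hasDeriv_right_of_le (zero_le_one (α := ℝ))
    (fun x hx => (hasDerivAt_log_ratio hr hx).continuousAt.continuousWithinAt)
    (fun x hx => (hasDerivAt_log_ratio hr ⟨hx.1.le, hx.2.le⟩).hasDerivWithinAt)
    ((intervalIntegrable_iff_integrableOn_Icc_of_le zero_le_one).1 (intervalIntegrable_ellK hr'))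
    (fun x hx => ?_)
  · simpa [ellK] using h
  · have h1 : 0 < 1 - x ^ 2 := by nlinarith [hx.1, hx.2]
    have h2 : 1 - x ^ 2 ≤ 1 - r ^ 2 * x ^ 2 := by
      have : r ^ 2 ≤ 1 := by nlinarith [hr.1, hr.2]
      nlinarith [sq_nonneg x]
    have h3 : 0 < 1 - r ^ 2 * x ^ 2 := by linarith
    have : √((1 - x ^ 2) * (1 - r ^ 2 * x ^ 2)) ≤ 1 - r ^ 2 * x ^ 2 :=
      Real.sqrt_le_iff.2 ⟨h3.le, by nlinarith⟩
    have : 0 < √((1 - x ^ 2) * (1 - r ^ 2 * x ^ 2)) := Real.sqrt_pos.2 (mul_pos h1 h3)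
    gcongr

theorem ellK_le_log_ratio_add_one {r : ℝ} (hr : r ∈ Ioo (0:ℝ) 1) :
    ellK r ≤ (Real.log (1 + r) - Real.log (1 - r)) / (2 * r) + 1 := by
  have hr' : |r| < 1 := by rw [abs_of_pos hr.1]; exact hr.2
  have h := intervalIntegral.integral_le_sub_of_hasDeriv_right_of_le (zero_le_one (α := ℝ))
    (g := fun y => (Real.log (1 + r * y) - Real.log (1 - r * y)) / (2 * r) +
      -(√(1 - y ^ 2) / √(1 - r ^ 2 * y ^ 2)))
    (fun x hx => ?_)
    (fun x hx => ((hasDerivAt_log_ratio hr ⟨hx.1.le, hx.2.le⟩).add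
      (hasDerivAt_sqrt_ratio hr hx)).hasDerivWithinAt)
    ((intervalIntegrable_iff_integrableOn_Icc_of_le zero_le_one).1 (intervalIntegrable_ellK hr'))
    (fun x hx => ?_)
  · simpa [ellK] using h
  · have := one_sub_sq_le_one_sub_sq_mul_sq hr.1.le le_rfl hx
    have h2 : 0 < 1 - r ^ 2 * x ^ 2 := by nlinarith [hr.1, hr.2]
    refine ((hasDerivAt_log_ratio hr hx).continuousAt.add
      (ContinuousAt.neg (ContinuousAt.div ?_ ?_ (Real.sqrt_pos.2 h2).ne'))).continuousWithinAt
    all_goals fun_prop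
  · have h1 : 0 < 1 - x ^ 2 := by nlinarith [hx.1, hx.2]
    have := one_sub_sq_le_one_sub_sq_mul_sq hr.1.le le_rfl ⟨hx.1.le, hx.2.le⟩
    have hr1 : 0 < 1 - r ^ 2 := by nlinarith [hr.1, hr.2]
    have h2 : 0 < 1 - r ^ 2 * x ^ 2 := by linarith
    rw [ellK_integrand_eq ⟨hx.1.le, hx.2.le⟩]
    have ha := Real.sqrt_pos.2 h1
    have hb := Real.sqrt_pos.2 h2
    have ha2 := Real.sq_sqrt h1.le
    have hb2 := Real.sq_sqrt h2.le
    generalize √(1 - x ^ 2) = a at *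
    generalize √(1 - r ^ 2 * x ^ 2) = b at *
    rw [← hb2, ← sub_nonneg]
    have key : b * (b - a) ≤ (1 - r ^ 2) * x := by
      have e : b ^ 2 - a ^ 2 = (1 - r ^ 2) * x ^ 2 := by rw [ha2, hb2]; ring
      have hab : 0 ≤ b - a := by
        by_contra! hlt
        nlinarith [mul_nonneg hr1.le (sq_nonneg x)]
      calc b * (b - a) ≤ (b + a) * (b - a) := by gcongr; linarith
        _ = (1 - r ^ 2) * x ^ 2 := by rw [← e]; ring
        _ ≤ (1 - r ^ 2) * x := by gcongr; nlinarith [hx.1, hx.2]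
    have : 1 / b ^ 2 + (1 - r ^ 2) * x / (a * b ^ 3) - 1 / a * (1 / b) =
        ((1 - r ^ 2) * x - b * (b - a)) / (a * b ^ 3) := by
      field_simp
      ring
    rw [this]
    exact div_nonneg (by linarith) (by positivity)

theorem tendsto_log_one_div_one_sub :
    Tendsto (fun r : ℝ => Real.log (1 / (1 - r))) (𝓝[<] 1) atTop := by
  refine Real.tendsto_log_atTop.comp ?_
  simp only [one_div]
  refine tendsto_inv_nhdsGT_zero.comp (tendsto_nhdsWithin_iff.2 ⟨?_, ?_⟩)
  · have : Tendsto (fun r : ℝ => 1 - r) (𝓝 1) (𝓝 (1 - 1)) := by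
      apply Continuous.tendsto; fun_prop
    simpa using this.mono_left nhdsWithin_le_nhds
  · filter_upwards [self_mem_nhdsWithin] with r hr
    simpa using hr

theorem tendsto_ellK_div_log :
    Tendsto (fun r => 2 * ellK r / Real.log (1 / (1 - r))) (𝓝[<] 1) (𝓝 1) := by
  have hL := tendsto_log_one_div_one_sub
  have hr : Tendsto (fun r : ℝ => r) (𝓝[<] 1) (𝓝 1) := tendsto_id.mono_left nhdsWithin_le_nhds
  have hlog : Tendsto (fun r : ℝ => Real.log (1 + r)) (𝓝[<] 1) (𝓝 (Real.log (1 + 1))) :=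
    (hr.const_add 1).log (by norm_num)
  have hlow : Tendsto (fun r : ℝ => (Real.log (1 + r) / Real.log (1 / (1 - r)) + 1) / r)
      (𝓝[<] 1) (𝓝 1) := by
    have h := ((hlog.div_atTop hL).add_const 1).div hr one_ne_zero
    rwa [zero_add, div_one] at h
  have hup : Tendsto (fun r : ℝ => (Real.log (1 + r) / Real.log (1 / (1 - r)) + 1) / r +
      2 / Real.log (1 / (1 - r))) (𝓝[<] 1) (𝓝 1) := by
    simpa using hlow.add (tendsto_const_nhds.div_atTop hL)
  have hmem : ∀ᶠ r : ℝ in 𝓝[<] 1, r ∈ Ioo (0:ℝ) 1 := Ioo_mem_nhdsLT zero_lt_one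
  refine tendsto_of_tendsto_of_tendsto_of_le_of_le' hlow hup ?_ ?_
  · filter_upwards [hmem, hL.eventually_gt_atTop 0] with r hr hpos
    have h := log_ratio_le_ellK hr
    have hr0 := hr.1
    rw [one_div, Real.log_inv] at *
    have hne : Real.log (1 - r) ≠ 0 := (neg_pos.1 hpos).ne
    rw [le_div_iff₀ hpos]
    refine le_trans (le_of_eq ?_) (mul_le_mul_of_nonneg_left h zero_le_two)
    field_simp
    ring
  · filter_upwards [hmem, hL.eventually_gt_atTop 0] with r hr hpos
    have h := ellK_le_log_ratio_add_one hr
    have hr0 := hr.1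
    rw [one_div, Real.log_inv] at *
    have hne : Real.log (1 - r) ≠ 0 := (neg_pos.1 hpos).ne
    rw [div_le_iff₀ hpos]
    refine (mul_le_mul_of_nonneg_left h zero_le_two).trans (le_of_eq ?_)
    field_simp
    ring

theorem tendsto_ellK_atTop : Tendsto ellK (𝓝[<] 1) atTop := by
  have h := (tendsto_ellK_div_log.pos_mul_atTop one_pos tendsto_log_one_div_one_sub).atTop_div_const
    (zero_lt_two (α := ℝ))
  refine h.congr' ?_
  filter_upwards [tendsto_log_one_div_one_sub.eventually_gt_atTop 0] with r hr
  field_simp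

theorem sqrt_one_sub_sq_mem_Ioo {k : ℝ} (hk : k ∈ Ioo (0:ℝ) 1) : √(1 - k ^ 2) ∈ Ioo (0:ℝ) 1 := by
  have h1 : 0 < 1 - k ^ 2 := by nlinarith [hk.1, hk.2]
  refine ⟨Real.sqrt_pos.2 h1, ?_⟩
  rw [Real.sqrt_lt' one_pos]
  nlinarith [hk.1]

theorem tendsto_ellK_compl_left : Tendsto (fun k => ellK √(1 - k ^ 2)) (𝓝[>] 0) atTop := by
  refine tendsto_ellK_atTop.comp (tendsto_nhdsWithin_iff.2 ⟨?_, ?_⟩)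
  · have : Tendsto (fun k : ℝ => √(1 - k ^ 2)) (𝓝 0) (𝓝 √(1 - 0 ^ 2)) := by
      apply Continuous.tendsto; fun_prop
    simpa using this.mono_left nhdsWithin_le_nhds
  · filter_upwards [Ioo_mem_nhdsGT (zero_lt_one (α := ℝ))] with k hk
    exact (sqrt_one_sub_sq_mem_Ioo hk).2

theorem tendsto_ellK_compl_right :
    Tendsto (fun k => ellK √(1 - k ^ 2)) (𝓝[<] 1) (𝓝 (π / 2)) := by
  rw [← ellK_zero]
  refine (continuousAt_ellK (by simp)).tendsto.comp ?_
  have : Tendsto (fun k : ℝ => √(1 - k ^ 2)) (𝓝 1) (𝓝 √(1 - 1 ^ 2)) := by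
    apply Continuous.tendsto; fun_prop
  simpa using this.mono_left nhdsWithin_le_nhds

theorem strictMonoOn_ellK_ratio :
    StrictMonoOn (fun k => 2 * ellK k / ellK √(1 - k ^ 2)) (Ioo 0 1) := by
  intro r hr s hs hrs
  have hr' := sqrt_one_sub_sq_mem_Ioo hr
  have hs' := sqrt_one_sub_sq_mem_Ioo hs
  have h1 : ellK r < ellK s := strictMonoOn_ellK (Ioo_subset_Ico_self hr)
    (Ioo_subset_Ico_self hs) hrs
  have h2 : √(1 - s ^ 2) < √(1 - r ^ 2) :=
    Real.sqrt_lt_sqrt (by nlinarith [hs.1, hs.2]) (by nlinarith [hr.1])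
  have h3 := strictMonoOn_ellK (Ioo_subset_Ico_self hs') (Ioo_subset_Ico_self hr') h2
  have := ellK_pos (Ioo_subset_Ico_self hs')
  have := ellK_pos (Ioo_subset_Ico_self hs)
  show 2 * ellK r / _ < 2 * ellK s / _
  gcongr

theorem continuousOn_ellK_ratio :
    ContinuousOn (fun k => 2 * ellK k / ellK √(1 - k ^ 2)) (Ioo 0 1) := by
  intro k hk
  have hk' := sqrt_one_sub_sq_mem_Ioo hk
  have h1 : ContinuousAt ellK k := continuousAt_ellK (by rw [abs_of_pos hk.1]; exact hk.2)
  have h2 : ContinuousAt ellK √(1 - k ^ 2) :=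
    continuousAt_ellK (by rw [abs_of_pos hk'.1]; exact hk'.2)
  have h3 : ContinuousAt (fun k => ellK √(1 - k ^ 2)) k :=
    ContinuousAt.comp (f := fun k : ℝ => √(1 - k ^ 2)) h2 (by fun_prop)
  exact ((h1.const_mul 2).div h3 (ellK_pos (Ioo_subset_Ico_self hk')).ne').continuousWithinAt

theorem surjOn_ellK_ratio :
    SurjOn (fun k => 2 * ellK k / ellK √(1 - k ^ 2)) (Ioo 0 1) (Ioi 0) := by
  intro H hH
  have hK : Tendsto (fun k => 2 * ellK k) (𝓝[>] 0) (𝓝 (2 * ellK 0)) :=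
    ((continuousAt_ellK (by simp)).tendsto.mono_left nhdsWithin_le_nhds).const_mul 2
  have hleft := hK.div_atTop tendsto_ellK_compl_left
  have hright : Tendsto (fun k => 2 * ellK k / ellK √(1 - k ^ 2)) (𝓝[<] 1) atTop := by
    simp only [div_eq_mul_inv]
    exact (tendsto_ellK_atTop.const_mul_atTop zero_lt_two).atTop_mul_pos
      (inv_pos.2 (half_pos Real.pi_pos)) (tendsto_ellK_compl_right.inv₀ (by positivity))
  obtain ⟨a, ha, ha'⟩ := ((hleft.eventually_lt_const hH).and
    (Ioo_mem_nhdsGT (zero_lt_one (α := ℝ)))).exists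
  obtain ⟨b, hb, hb'⟩ := ((hright.eventually_gt_atTop H).and
    (Ioo_mem_nhdsLT (zero_lt_one (α := ℝ)))).exists
  exact isPreconnected_Ioo.intermediate_value ha' hb' continuousOn_ellK_ratio ⟨ha.le, hb.le⟩

theorem tendsto_log_div_ellK_ratio :
    Tendsto (fun k => Real.log (1 / (1 - k)) / (π / 2 * (2 * ellK k / ellK √(1 - k ^ 2))))
      (𝓝[<] 1) (𝓝 1) := by
  have h := (tendsto_ellK_compl_right.div_const (π / 2)).mul
    (tendsto_ellK_div_log.inv₀ one_ne_zero)
  rw [div_self (by positivity), inv_one, one_mul] at h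
  refine h.congr fun k => ?_
  simp only [div_eq_mul_inv, mul_inv, inv_inv]
  ring

theorem implicit_k_asymp :
    (∀ H > (0:ℝ), ∃! k : ℝ, k ∈ Set.Ioo (0:ℝ) 1 ∧
        2 * ellK k / ellK (Real.sqrt (1 - k ^ 2)) = H) ∧
    ∀ k : ℝ → ℝ,
      (∀ H > (0:ℝ), k H ∈ Set.Ioo (0:ℝ) 1 ∧
          2 * ellK (k H) / ellK (Real.sqrt (1 - k H ^ 2)) = H) →
      Tendsto k atTop (nhds 1) ∧
      Tendsto (fun H => Real.log (1 / (1 - k H)) / (Real.pi / 2 * H)) atTop (nhds 1) := by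
  refine ⟨fun H hH => ?_, fun k hk => ?_⟩
  · obtain ⟨k, hk, hkH⟩ := surjOn_ellK_ratio hH
    exact ⟨k, ⟨hk, hkH⟩, fun y hy =>
      strictMonoOn_ellK_ratio.injOn hy.1 hk (hy.2.trans hkH.symm)⟩
  · have hlim : Tendsto k atTop (𝓝 1) := by
      refine tendsto_order.2 ⟨fun c hc => ?_, fun c hc => ?_⟩
      · obtain ⟨d, hd, hd1⟩ := exists_between (max_lt hc (zero_lt_one (α := ℝ)))
        have hd' : d ∈ Ioo (0:ℝ) 1 := ⟨(le_max_right _ _).trans_lt hd, hd1⟩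
        filter_upwards [eventually_gt_atTop 0,
          eventually_gt_atTop (2 * ellK d / ellK √(1 - d ^ 2))] with H hH hHd
        rw [← (hk H hH).2] at hHd
        exact ((le_max_left _ _).trans_lt hd).trans
          ((strictMonoOn_ellK_ratio.lt_iff_lt hd' (hk H hH).1).1 hHd)
      · filter_upwards [eventually_gt_atTop 0] with H hH
        exact (hk H hH).1.2.trans hc
    have hlim' : Tendsto k atTop (𝓝[<] 1) := by
      refine tendsto_nhdsWithin_iff.2 ⟨hlim, ?_⟩
      filter_upwards [eventually_gt_atTop 0] with H hH
      exact (hk H hH).1.2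
    refine ⟨hlim, (tendsto_log_div_ellK_ratio.comp hlim').congr' ?_⟩
    filter_upwards [eventually_gt_atTop 0] with H hH
    simp only [Function.comp_apply, (hk H hH).2]
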